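/- arXiv:2410.10405 — 3 statements merged into one kernel-verified Lean document; each statement's English description precedes it below -/
import Mathlib

section
/- Let h > 0, let φ_1 and φ_2 be G-convex external fields on the unions of disjoint intervals (a_1,b_1) ∪ (c_1,d_1) and (a_2,b_2) ∪ (c_2,d_2) respectively (possibly unbounded), and let x_{1,1} < ... < x_{n_1+n_2,1} and x_{1,2} < ... < x_{n_1+n_2,2} be their respective (n_1,n_2)-equilibrium distributions. If a_1 = a_2, c_1 = c_2, b_1 ≤ b_2, d_1 ≤ d_2 and F_{φ_1}(x) < F_{φ_2}(x) for all x ∈ (a_1,b_1) ∪ (c_1,d_1), then x_{j,1} < x_{j,2} for every j = 1,...,n_1+n_2. -/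
open Polynomial Filter

noncomputable def deltaOp (h : ℝ) (f : ℝ → ℝ) (x : ℝ) : ℝ := f (x + h) - f x

noncomputable def nablaOp (h : ℝ) (f : ℝ → ℝ) (x : ℝ) : ℝ := f x - f (x - h)

noncomputable def forceF (h x y : ℝ) : ℝ := 1 / (2 * h) * Real.log ((y - x + h) / (y - x - h))

noncomputable def potV (h x y : ℝ) : ℝ :=
  (x - y) / (2 * h) * Real.log ((y - x + h) / (y - x - h))
    - 1 / 2 * Real.log ((y - x + h) * (y - x - h))

noncomputable def extForce (h : ℝ) (A B : Polynomial ℝ) (x : ℝ) : ℝ :=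
  1 / (2 * h) * Real.log (1 + B.eval x / A.eval x)

noncomputable def energy (h : ℝ) (φ : ℝ → ℝ) {n : ℕ} (x : Fin n → ℝ) : ℝ :=
  (∑ j, ∑ k ∈ Finset.univ.erase j, potV h (x k) (x j)) + 2 * ∑ j, φ (x j)

def GapGt (h : ℝ) {n : ℕ} (x : Fin n → ℝ) : Prop :=
  ∀ i : ℕ, ∀ hi : i + 1 < n, x ⟨i + 1, hi⟩ - x ⟨i, Nat.lt_of_succ_lt hi⟩ > h

def SatisfiesDiffEq (h : ℝ) (A B C p : Polynomial ℝ) : Prop :=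
  ∀ x : ℝ,
    A.eval x * deltaOp h (nablaOp h fun t => p.eval t) x
      + B.eval x * deltaOp h (fun t => p.eval t) x + C.eval x * p.eval x = 0

def InIoo (a b : EReal) (y : ℝ) : Prop := a < (y : EReal) ∧ (y : EReal) < b

def IsCriticalDist (h : ℝ) (A B : Polynomial ℝ) (a b : EReal) {n : ℕ}
    (x : Fin n → ℝ) : Prop :=
  StrictMono x ∧ (∀ j, InIoo a b (x j)) ∧ GapGt h x ∧
    ∀ j, (∑ k ∈ Finset.univ.erase j, forceF h (x k) (x j)) + extForce h A B (x j) = 0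

def Admissible (h : ℝ) (a b : EReal) {n : ℕ} (x : Fin n → ℝ) : Prop :=
  StrictMono x ∧ (∀ j, a ≤ (x j : EReal) ∧ (x j : EReal) ≤ b) ∧ GapGt h x

def IsEquilibrium (h : ℝ) (φ : ℝ → ℝ) (a b : EReal) {n : ℕ} (x : Fin n → ℝ) : Prop :=
  Admissible h a b x ∧ ∀ y : Fin n → ℝ, Admissible h a b y → energy h φ x ≤ energy h φ y

noncomputable def ratFn (A B : Polynomial ℝ) (x : ℝ) : ℝ := 1 + B.eval x / A.eval x

def GConvexOn (A B : Polynomial ℝ) (a b : EReal) : Prop :=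
  a < b ∧
  (∀ x : ℝ, InIoo a b x → 0 < ratFn A B x) ∧
  (∀ x y : ℝ, InIoo a b x → InIoo a b y → x < y → ratFn A B y < ratFn A B x) ∧
  (∀ a' : ℝ, a = (a' : EReal) → A.eval a' = 0) ∧
  (a = ⊥ → (Tendsto (ratFn A B) atBot atTop ∨
      ∃ L : ℝ, 1 < L ∧ Tendsto (ratFn A B) atBot (nhds L))) ∧
  (∀ b' : ℝ, b = (b' : EReal) → (A + B).eval b' = 0) ∧
  (b = ⊤ → ∃ L : ℝ, 0 ≤ L ∧ L < 1 ∧ Tendsto (ratFn A B) atTop (nhds L))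

def IsPotential (h : ℝ) (A B : Polynomial ℝ) (a b : EReal) (φ : ℝ → ℝ) : Prop :=
  ∀ x : ℝ, InIoo a b x → HasDerivAt φ (-(extForce h A B x)) x

noncomputable def partialD {n : ℕ} (f : (Fin n → ℝ) → ℝ) (j : Fin n) (z : Fin n → ℝ) : ℝ :=
  deriv (fun t => f (Function.update z j t)) (z j)

noncomputable def poch (t : ℝ) (k : ℕ) : ℝ := (ascPochhammer ℝ k).eval t

noncomputable def negXPoch (k : ℕ) : Polynomial ℝ := (ascPochhammer ℝ k).comp (-Polynomial.X)

noncomputable def charlier (n : ℕ) (a : ℝ) : Polynomial ℝ :=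
  ∑ k ∈ Finset.range (n + 1),
    Polynomial.C (poch (-(n : ℝ)) k / (k.factorial : ℝ) * (-1 / a) ^ k) * negXPoch k

noncomputable def krawtchouk (n : ℕ) (p : ℝ) (N : ℕ) : Polynomial ℝ :=
  ∑ k ∈ Finset.range (n + 1),
    Polynomial.C (poch (-(n : ℝ)) k / ((k.factorial : ℝ) * poch (-(N : ℝ)) k) * (1 / p) ^ k) *
      negXPoch k

noncomputable def meixner (n : ℕ) (β c : ℝ) : Polynomial ℝ :=
  ∑ k ∈ Finset.range (n + 1),
    Polynomial.C (poch (-(n : ℝ)) k / ((k.factorial : ℝ) * poch β k) * (1 - 1 / c) ^ k) *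
      negXPoch k

noncomputable def hahn (n : ℕ) (α β : ℝ) (N : ℕ) : Polynomial ℝ :=
  ∑ k ∈ Finset.range (n + 1),
    Polynomial.C (poch (-(n : ℝ)) k * poch ((n : ℝ) + α + β + 1) k /
        ((k.factorial : ℝ) * poch (α + 1) k * poch (-(N : ℝ)) k)) * negXPoch k

def IsRootTuple {n : ℕ} (p : Polynomial ℝ) (x : Fin n → ℝ) : Prop :=
  StrictMono x ∧ ∀ y : ℝ, p.IsRoot y ↔ ∃ j, y = x j

/-- An admissible `(n₁,n₂)`-configuration: the first `n₁` points in `(a,b)`, the last `n₂`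
points in `(c,d)`, and all mutual distances greater than `h`. -/
def Admissible2 (h : ℝ) (a b c d : EReal) (n₁ n₂ : ℕ) (x : Fin (n₁ + n₂) → ℝ) : Prop :=
  (∀ j : Fin (n₁ + n₂), if (j : ℕ) < n₁ then InIoo a b (x j) else InIoo c d (x j)) ∧
    ∀ j k, j ≠ k → |x j - x k| > h

/-- An `(n₁,n₂)`-equilibrium distribution: an admissible configuration minimizing the energy
among all admissible configurations. -/
def IsEquilibrium2 (h : ℝ) (φ : ℝ → ℝ) (a b c d : EReal) (n₁ n₂ : ℕ)
    (x : Fin (n₁ + n₂) → ℝ) : Prop :=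
  Admissible2 h a b c d n₁ n₂ x ∧
    ∀ y : Fin (n₁ + n₂) → ℝ, Admissible2 h a b c d n₁ n₂ y →
      energy h φ x ≤ energy h φ y

theorem potV_comm (h x y : ℝ) : potV h x y = potV h y x := by
  have e₁ : (x - y + h) / (x - y - h) = ((y - x + h) / (y - x - h))⁻¹ := by
    rw [inv_div, ← neg_div_neg_eq]
    congr 1 <;> ring
  have e₂ : (x - y + h) * (x - y - h) = (y - x + h) * (y - x - h) := by ring
  unfold potV
  rw [e₁, e₂, Real.log_inv]
  ring

theorem forceF_comm (h x y : ℝ) : forceF h x y = -forceF h y x := by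
  have e : (x - y + h) / (x - y - h) = ((y - x + h) / (y - x - h))⁻¹ := by
    rw [inv_div, ← neg_div_neg_eq]
    congr 1 <;> ring
  unfold forceF
  rw [e, Real.log_inv]
  ring

theorem hasDerivAt_potV {h : ℝ} (hh : 0 < h) {x y : ℝ} (hxy : h < |y - x|) :
    HasDerivAt (potV h x) (-forceF h x y) y := by
  have hpos : 0 < (y - x + h) * (y - x - h) := by
    have := sq_lt_sq' (by linarith) hxy
    rw [sq_abs] at this
    nlinarith
  have hp : y - x + h ≠ 0 := left_ne_zero_of_mul hpos.ne'
  have hm : y - x - h ≠ 0 := right_ne_zero_of_mul hpos.ne'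
  have d₀ : HasDerivAt (fun t => x - t) (-1) y := (hasDerivAt_id y).const_sub x
  have d₁ : HasDerivAt (fun t => t - x + h) 1 y := ((hasDerivAt_id y).sub_const x).add_const h
  have d₂ : HasDerivAt (fun t => t - x - h) 1 y := ((hasDerivAt_id y).sub_const x).sub_const h
  have d₃ := ((d₀.div_const (2 * h)).mul ((d₁.div d₂ hm).log (div_ne_zero hp hm))).sub
    (((d₁.mul d₂).log hpos.ne').const_mul (1 / 2))
  refine d₃.congr_deriv ?_
  simp only [forceF, Pi.mul_apply, Pi.div_apply]
  field_simp
  ring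

theorem forceF_le_forceF_of_lt {h : ℝ} (hh : 0 < h) {x y x' y' : ℝ} (hxy : h < y - x)
    (hle : y - x ≤ y' - x') : forceF h x' y' ≤ forceF h x y := by
  unfold forceF
  have h₁ : 0 < y' - x' - h := by linarith
  have h₂ : 0 < y - x - h := by linarith
  have h₃ : 0 < y' - x' + h := by linarith
  gcongr 1 / (2 * h) * Real.log ?_
  rw [div_le_div_iff₀ h₁ h₂]
  nlinarith

/-- The energy is stationary in each coordinate at an equilibrium distribution. -/
theorem IsEquilibrium2.sum_forceF_add_extForce_eq_zero {h : ℝ} (hh : 0 < h) {A B : Polynomial ℝ}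
    {a b c d : EReal} {φ : ℝ → ℝ} (hab : IsPotential h A B a b φ) (hcd : IsPotential h A B c d φ)
    {n₁ n₂ : ℕ} {x : Fin (n₁ + n₂) → ℝ} (hx : IsEquilibrium2 h φ a b c d n₁ n₂ x)
    (j : Fin (n₁ + n₂)) :
    (∑ k ∈ Finset.univ.erase j, forceF h (x k) (x j)) + extForce h A B (x j) = 0 := by
  obtain ⟨⟨hmem, hgap⟩, hmin⟩ := hx
  have hφ : HasDerivAt φ (-(extForce h A B (x j))) (x j) := by
    have := hmem j
    split_ifs at this
    exacts [hab _ this, hcd _ this]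
  have hloc : IsLocalMin (fun t => energy h φ (Function.update x j t)) (x j) := by
    have hopen : ∀ (p q : EReal), InIoo p q (x j) → ∀ᶠ t in nhds (x j), InIoo p q t :=
      fun p q hpq => (continuous_coe_real_ereal.continuousAt.eventually
        (lt_mem_nhds hpq.1)).and (continuous_coe_real_ereal.continuousAt.eventually
        (gt_mem_nhds hpq.2))
    have ev₁ : ∀ᶠ t in nhds (x j),
        if (j : ℕ) < n₁ then InIoo a b t else InIoo c d t := by
      have := hmem j
      split_ifs at this ⊢
      exacts [hopen _ _ this, hopen _ _ this]
    have ev₂ : ∀ᶠ t in nhds (x j), ∀ k, k ≠ j → |t - x k| > h := by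
      rw [Filter.eventually_all]
      intro k
      by_cases hk : k = j
      · simp [hk]
      · have hc : ContinuousAt (fun t : ℝ => |t - x k|) (x j) := by fun_prop
        filter_upwards [hc.eventually (lt_mem_nhds (hgap j k (Ne.symm hk)))] with t ht _
        exact ht
    filter_upwards [ev₁, ev₂] with t ht₁ ht₂
    rw [Function.update_eq_self]
    refine hmin _ ⟨fun i => ?_, fun i k hik => ?_⟩
    · by_cases hi : i = j
      · subst hi; simpa using ht₁
      · simpa [hi] using hmem i
    · by_cases hi : i = j
      · subst hi
        simpa [Ne.symm hik] using ht₂ k (Ne.symm hik)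
      · by_cases hk : k = j
        · subst hk
          simpa [hik, abs_sub_comm] using ht₂ i hik
        · simpa [hi, hk] using hgap i k hik
  have hpair : ∀ i, ∀ k ∈ Finset.univ.erase i,
      HasDerivAt (fun t => potV h (Function.update x j t k) (Function.update x j t i))
        ((if i = j then -forceF h (x k) (x j) else 0)
          + if k = j then -forceF h (x i) (x j) else 0) (x j) := by
    intro i k hk
    have hki : k ≠ i := Finset.ne_of_mem_erase hk
    by_cases hi : i = j
    · subst hi
      simpa [hki] using hasDerivAt_potV hh (hgap i k hki.symm)
    · by_cases hkj : k = j
      · subst hkj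
        simp only [potV_comm h (Function.update x k _ k)]
        simpa [hi] using hasDerivAt_potV hh (hgap k i hki)
      · simpa [hi, hkj] using hasDerivAt_const (x j) (potV h (x k) (x i))
  have hsingle : ∀ i ∈ Finset.univ, HasDerivAt (fun t => φ (Function.update x j t i))
      (if i = j then -(extForce h A B (x j)) else 0) (x j) := by
    intro i _
    by_cases hi : i = j
    · subst hi; simpa using hφ
    · simpa [hi] using hasDerivAt_const (x j) (φ (x i))
  have hderiv := (HasDerivAt.fun_sum fun i (_ : i ∈ Finset.univ) =>
    HasDerivAt.fun_sum (hpair i)).add ((HasDerivAt.fun_sum hsingle).const_mul 2)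
  have hzero := hloc.hasDerivAt_eq_zero hderiv
  have e₁ : ∑ i, ∑ k ∈ Finset.univ.erase i, (if i = j then -forceF h (x k) (x j) else 0)
      = -∑ k ∈ Finset.univ.erase j, forceF h (x k) (x j) := by
    rw [Finset.sum_eq_single j] <;> simp +contextual
  have e₂ : ∑ i, ∑ k ∈ Finset.univ.erase i, (if k = j then -forceF h (x i) (x j) else 0)
      = -∑ k ∈ Finset.univ.erase j, forceF h (x k) (x j) := by
    rw [← Finset.sum_neg_distrib, ← Finset.sum_subset (Finset.erase_subset j Finset.univ)]
    · refine Finset.sum_congr rfl fun i hi => ?_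
      simp [(Finset.ne_of_mem_erase hi).symm]
    · simp
  simp only [Finset.sum_add_distrib] at hzero
  rw [e₁, e₂, Finset.sum_ite_eq', if_pos (Finset.mem_univ j)] at hzero
  linarith

theorem sum_forceF_le_sum_forceF {h : ℝ} (hh : 0 < h) {n : ℕ} {x y : Fin n → ℝ}
    (hx : StrictMono x) (hy : StrictMono y) (hxgap : ∀ j k, j ≠ k → |x j - x k| > h)
    (hygap : ∀ j k, j ≠ k → |y j - y k| > h) {j : Fin n}
    (hj : ∀ k, x k - y k ≤ x j - y j) :
    ∑ k ∈ Finset.univ.erase j, forceF h (x k) (x j)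
      ≤ ∑ k ∈ Finset.univ.erase j, forceF h (y k) (y j) := by
  refine Finset.sum_le_sum fun k hk => ?_
  have hle := hj k
  rcases lt_or_gt_of_ne (Finset.ne_of_mem_erase hk) with hkj | hkj
  · have hgap := hygap j k hkj.ne'
    rw [abs_of_pos (sub_pos.2 (hy hkj))] at hgap
    exact forceF_le_forceF_of_lt hh hgap (by linarith)
  · have hgap := hxgap k j hkj.ne'
    rw [abs_of_pos (sub_pos.2 (hx hkj))] at hgap
    rw [forceF_comm h (x k), forceF_comm h (y k), neg_le_neg_iff]
    exact forceF_le_forceF_of_lt hh hgap (by linarith)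

theorem GConvexOn.extForce_le {h : ℝ} (hh : 0 < h) {A B : Polynomial ℝ} {a b : EReal}
    (hG : GConvexOn A B a b) {x y : ℝ} (hx : InIoo a b x) (hy : InIoo a b y) (hxy : x ≤ y) :
    extForce h A B y ≤ extForce h A B x := by
  rcases hxy.eq_or_lt with rfl | hlt
  · rfl
  · have hle := Real.log_le_log (hG.2.1 y hy) (hG.2.2.1 x y hx hy hlt).le
    exact mul_le_mul_of_nonneg_left hle (by positivity)

/-- monotonicity of `(n₁,n₂)`-equilibrium distributions on unions of two
disjoint intervals under comparison of the external forces. -/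
theorem two_interval_equilibrium_monotone_of_force_lt
    (h : ℝ) (hh : 0 < h)
    (A₁ B₁ A₂ B₂ : Polynomial ℝ) (a₁ b₁ c₁ d₁ a₂ b₂ c₂ d₂ : EReal) (φ₁ φ₂ : ℝ → ℝ)
    (hdisj₁ : b₁ ≤ c₁) (hdisj₂ : b₂ ≤ c₂)
    (hG₁ab : GConvexOn A₁ B₁ a₁ b₁) (hG₁cd : GConvexOn A₁ B₁ c₁ d₁)
    (hG₂ab : GConvexOn A₂ B₂ a₂ b₂) (hG₂cd : GConvexOn A₂ B₂ c₂ d₂)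
    (hφ₁ab : IsPotential h A₁ B₁ a₁ b₁ φ₁) (hφ₁cd : IsPotential h A₁ B₁ c₁ d₁ φ₁)
    (hφ₂ab : IsPotential h A₂ B₂ a₂ b₂ φ₂) (hφ₂cd : IsPotential h A₂ B₂ c₂ d₂ φ₂)
    (n₁ n₂ : ℕ) (x₁ x₂ : Fin (n₁ + n₂) → ℝ)
    (hx₁ : StrictMono x₁) (hx₂ : StrictMono x₂)
    (he₁ : IsEquilibrium2 h φ₁ a₁ b₁ c₁ d₁ n₁ n₂ x₁)
    (he₂ : IsEquilibrium2 h φ₂ a₂ b₂ c₂ d₂ n₁ n₂ x₂)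
    (ha : a₁ = a₂) (hc : c₁ = c₂) (hb : b₁ ≤ b₂) (hd : d₁ ≤ d₂)
    (hF : ∀ x : ℝ, InIoo a₁ b₁ x ∨ InIoo c₁ d₁ x →
      extForce h A₁ B₁ x < extForce h A₂ B₂ x) :
    ∀ j, x₁ j < x₂ j := by
  subst ha hc
  intro j₀
  by_contra! hj₀
  obtain ⟨j, -, hj⟩ := Finset.exists_max_image Finset.univ (fun k => x₁ k - x₂ k)
    ⟨j₀, Finset.mem_univ _⟩
  have hle : x₂ j ≤ x₁ j := by
    have := hj j₀ (Finset.mem_univ _)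
    linarith
  have hsum := sum_forceF_le_sum_forceF hh hx₁ hx₂ he₁.1.2 he₂.1.2
    fun k => hj k (Finset.mem_univ _)
  have hcrit₁ := he₁.sum_forceF_add_extForce_eq_zero hh hφ₁ab hφ₁cd j
  have hcrit₂ := he₂.sum_forceF_add_extForce_eq_zero hh hφ₂ab hφ₂cd j
  have hmem₁ := he₁.1.1 j
  have hmem₂ := he₂.1.1 j
  have hforce : extForce h A₁ B₁ (x₁ j) < extForce h A₂ B₂ (x₂ j) := by
    split_ifs at hmem₁ hmem₂
    · exact (hF _ (Or.inl hmem₁)).trans_le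
        (hG₂ab.extForce_le hh hmem₂ ⟨hmem₁.1, hmem₁.2.trans_le hb⟩ hle)
    · exact (hF _ (Or.inr hmem₁)).trans_le
        (hG₂cd.extForce_le hh hmem₂ ⟨hmem₁.1, hmem₁.2.trans_le hd⟩ hle)
  linarith
end

section
/- Let a > 0 and n ≥ 1, and let C_n(x;a) be the Charlier polynomial of degree n. Then C_n(·;a) has n simple real roots x_{1,n}(a) < x_{2,n}(a) < ... < x_{n,n}(a), all lying in (0,+∞), with x_{j+1,n}(a) - x_{j,n}(a) > 1 for j = 1,...,n-1. Moreover, each root is a strictly increasing function of a: if 0 < a_1 < a_2 then x_{j,n}(a_1) < x_{j,n}(a_2) for every j = 1,...,n. -/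
open Polynomial Filter

theorem charlier_eval (n : ℕ) (a t : ℝ) :
    (charlier n a).eval t =
      ∑ k ∈ Finset.range (n + 1), (n.choose k : ℝ) * a⁻¹ ^ k * (ascPochhammer ℝ k).eval (-t) := by
  rw [charlier, eval_finsetSum]
  refine Finset.sum_congr rfl fun k _ => ?_
  have hk : (k.factorial : ℝ) ≠ 0 := by positivity
  have hsign : ((-1 : ℝ) ^ k) * (-1) ^ k = 1 := by rw [← mul_pow]; norm_num
  have hpoch : poch (-(n : ℝ)) k / (k.factorial : ℝ) = (-1) ^ k * (n.choose k : ℝ) := by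
    rw [poch, ascPochhammer_eval_neg_eq_descPochhammer, descPochhammer_eval_eq_descFactorial,
      Nat.descFactorial_eq_factorial_mul_choose]
    push_cast
    field_simp
  rw [hpoch, div_eq_mul_inv, mul_pow, eval_mul, eval_C, negXPoch, eval_comp, eval_neg, eval_X]
  linear_combination (n.choose k : ℝ) * a⁻¹ ^ k * (ascPochhammer ℝ k).eval (-t) * hsign

theorem charlier_succ_eval (n : ℕ) (a t : ℝ) :
    (charlier (n + 1) a).eval t =
      (charlier n a).eval t - t * a⁻¹ * (charlier n a).eval (t - 1) := by
  have hasc (k : ℕ) : (ascPochhammer ℝ (k + 1)).eval (-t) =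
      -t * (ascPochhammer ℝ k).eval (-(t - 1)) := by
    rw [ascPochhammer_succ_left, eval_mul, eval_X, eval_comp, eval_add, eval_X, eval_one]
    congr 2
    ring
  have hext : (charlier n a).eval t = ∑ k ∈ Finset.range (n + 2),
      (n.choose k : ℝ) * a⁻¹ ^ k * (ascPochhammer ℝ k).eval (-t) := by
    rw [Finset.sum_range_succ, charlier_eval]
    simp
  rw [hext, charlier_eval (n + 1), charlier_eval n a (t - 1), Finset.sum_range_succ',
    Finset.sum_range_succ' _ (n + 1), Finset.mul_sum, add_sub_right_comm,
    ← Finset.sum_sub_distrib]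
  congr 1
  · refine Finset.sum_congr rfl fun k _ => ?_
    rw [hasc, Nat.choose_succ_succ]
    push_cast
    ring
  · simp

/-- If the points `x i`, `i < n`, are positive and separated by more than `1`, then the polynomial
`t ∏ (t - 1 - x i) - a ∏ (t - x i)` has a root in each gap `(x (j - 1) + 1, x j)`, where the
first gap starts at `0` and the last one is unbounded. -/
theorem exists_root_in_gap {a : ℝ} (ha : 0 < a) {n : ℕ} {x : ℕ → ℝ}
    (hpos : ∀ i < n, 0 < x i) (hgap : ∀ i j, i < j → j < n → x i + 1 < x j)
    {j : ℕ} (hj : j ≤ n) :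
    ∃ y : ℝ, 0 < y ∧ (∀ i < n, i < j → x i + 1 < y) ∧ (∀ i < n, j ≤ i → y < x i) ∧
      y * ∏ i ∈ Finset.range n, (y - 1 - x i) - a * ∏ i ∈ Finset.range n, (y - x i) = 0 := by
  obtain ⟨l, hl0, hlj, hjl, hl⟩ : ∃ l : ℝ, 0 ≤ l ∧ (∀ i < n, i < j → x i + 1 ≤ l) ∧
      (∀ i < n, j ≤ i → l < x i) ∧ l * ∏ i ∈ Finset.range n, (l - 1 - x i) = 0 := by
    cases j with
    | zero => exact ⟨0, le_rfl, fun i _ h => absurd h (by omega), fun i hi _ => hpos i hi, by simp⟩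
    | succ m =>
      refine ⟨x m + 1, ?_, fun i hi h => ?_, fun i hi h => hgap m i (by omega) hi, ?_⟩
      · linarith [hpos m (by omega)]
      · rcases Nat.lt_succ_iff_lt_or_eq.mp h with h | rfl
        · linarith [hgap i m h (by omega)]
        · exact le_rfl
      · rw [Finset.prod_eq_zero (Finset.mem_range.mpr (show m < n by omega)) (by ring), mul_zero]
  set ε : ℝ := ∏ i ∈ Finset.range n, (if i < j then 1 else -1) with hε
  set Q : ℝ → ℝ := fun t =>
    t * ∏ i ∈ Finset.range n, (t - 1 - x i) - a * ∏ i ∈ Finset.range n, (t - x i) with hQ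
  have hprod {s : ℝ} (h₁ : ∀ i < n, i < j → x i < s) (h₂ : ∀ i < n, j ≤ i → s < x i) :
      0 < ε * ∏ i ∈ Finset.range n, (s - x i) := by
    rw [hε, ← Finset.prod_mul_distrib]
    refine Finset.prod_pos fun i hi => ?_
    rw [Finset.mem_range] at hi
    split_ifs with h
    · linarith [h₁ i hi h]
    · linarith [h₂ i hi (not_lt.mp h)]
  have hQl : ε * Q l < 0 := by
    have := mul_pos ha (hprod (s := l) (fun i hi h => by linarith [hlj i hi h]) hjl)
    simp only [hQ, hl]
    linarith
  obtain ⟨u, hlu, hju, hQu⟩ : ∃ u : ℝ, l < u ∧ (∀ i < n, j ≤ i → u ≤ x i) ∧ 0 < ε * Q u := by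
    rcases hj.lt_or_eq with hjn | rfl
    · refine ⟨x j, hjl j hjn le_rfl, fun i hi h => ?_, ?_⟩
      · rcases h.lt_or_eq with h | rfl
        · linarith [hgap j i h hi]
        · exact le_rfl
      · have hzero : ∏ i ∈ Finset.range n, (x j - x i) = 0 :=
          Finset.prod_eq_zero (Finset.mem_range.mpr hjn) (sub_self _)
        have := mul_pos (hpos j hjn) (hprod (s := x j - 1)
          (fun i hi h => by linarith [hgap i j h hjn]) (fun i hi h => by
            rcases h.lt_or_eq with h | rfl
            · linarith [hgap j i h hi]
            · linarith))
        simp only [hQ, hzero]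
        linarith
    · have hsum : ∀ i < j, x i ≤ ∑ i ∈ Finset.range j, x i := fun i hi =>
        Finset.single_le_sum (f := x) (fun k hk => (hpos k (Finset.mem_range.mp hk)).le)
          (Finset.mem_range.mpr hi)
      have hsum0 : 0 ≤ ∑ i ∈ Finset.range j, x i :=
        Finset.sum_nonneg fun k hk => (hpos k (Finset.mem_range.mp hk)).le
      have ha2 : 0 < a * 2 ^ j := by positivity
      set T : ℝ := a * 2 ^ j + ∑ i ∈ Finset.range j, x i + l + 2 with hT
      have hε1 : ε = 1 := by
        rw [hε]
        exact Finset.prod_eq_one fun i hi => if_pos (Finset.mem_range.mp hi)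
      have hTpos : 0 < ∏ i ∈ Finset.range j, (T - x i) := Finset.prod_pos fun i hi => by
        linarith [hsum i (Finset.mem_range.mp hi)]
      have hle : ∏ i ∈ Finset.range j, (T - x i) / 2 ≤ ∏ i ∈ Finset.range j, (T - 1 - x i) := by
        refine Finset.prod_le_prod (fun i hi => ?_) fun i hi => ?_ <;>
          linarith [hsum i (Finset.mem_range.mp hi)]
      rw [Finset.prod_div_distrib, Finset.prod_const, Finset.card_range,
        div_le_iff₀ (by positivity)] at hle
      refine ⟨T, by linarith, fun i hi h => absurd h (by omega), ?_⟩
      rw [hε1, one_mul]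
      have hR : 0 < ∏ i ∈ Finset.range j, (T - 1 - x i) := Finset.prod_pos fun i hi => by
        linarith [hsum i (Finset.mem_range.mp hi)]
      have h₁ := mul_le_mul_of_nonneg_left hle ha.le
      have h₂ := mul_lt_mul_of_pos_right (show a * 2 ^ j < T by linarith) hR
      simp only [hQ]
      linarith
  have hcont : Continuous fun t => ε * Q t := by
    simp only [hQ]
    fun_prop
  obtain ⟨y, ⟨hly, hyu⟩, hy⟩ := intermediate_value_Ioo hlu.le hcont.continuousOn ⟨hQl, hQu⟩
  have hε0 : ε ≠ 0 := by
    rintro h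
    rw [h, zero_mul] at hQl
    exact lt_irrefl _ hQl
  exact ⟨y, hl0.trans_lt hly, fun i hi h => (hlj i hi h).trans_lt hly,
    fun i hi h => hyu.trans_le (hju i hi h), (mul_eq_zero.mp hy).resolve_left hε0⟩

/-- A monic polynomial of degree `n + 1` of the given shape factors through `n + 1` distinct
zeros. -/
theorem prod_sub_eq_of_roots {a : ℝ} {n : ℕ} {x y : ℕ → ℝ}
    (hinj : Set.InjOn y (Finset.range (n + 1)))
    (hy : ∀ j < n + 1, y j * ∏ i ∈ Finset.range n, (y j - 1 - x i)
      - a * ∏ i ∈ Finset.range n, (y j - x i) = 0) (t : ℝ) :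
    t * ∏ i ∈ Finset.range n, (t - 1 - x i) - a * ∏ i ∈ Finset.range n, (t - x i) =
      ∏ j ∈ Finset.range (n + 1), (t - y j) := by
  set F : ℝ[X] := X * ∏ i ∈ Finset.range n, (X - C (1 + x i)) with hF
  set G : ℝ[X] := C a * ∏ i ∈ Finset.range n, (X - C (x i)) with hG
  set H : ℝ[X] := ∏ j ∈ Finset.range (n + 1), (X - C (y j)) with hH
  have hFm : F.Monic := monic_X.mul (monic_prod_X_sub_C _ _)
  have hHm : H.Monic := monic_prod_X_sub_C _ _
  have hFd : F.degree = (n + 1 : ℕ) := by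
    rw [hF, degree_mul, degree_X, degree_prod]
    simp only [degree_X_sub_C, Finset.sum_const, Finset.card_range, nsmul_eq_mul, mul_one]
    push_cast
    exact add_comm _ _
  have hHd : H.degree = (n + 1 : ℕ) := by
    rw [hH, degree_prod]
    simp
  have hGd : G.degree < (n + 1 : ℕ) := by
    rw [hG, ← smul_eq_C_mul]
    refine (degree_smul_le a _).trans_lt ?_
    rw [degree_prod]
    simp only [degree_X_sub_C, Finset.sum_const, Finset.card_range, nsmul_eq_mul, mul_one]
    exact_mod_cast Nat.lt_succ_self n
  have hdeg : (F - G - H).degree < (Finset.range (n + 1)).card := by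
    rw [Finset.card_range, show F - G - H = (F - H) - G by ring]
    refine (degree_sub_le _ _).trans_lt (max_lt ?_ hGd)
    rw [← hFd]
    exact degree_sub_lt_left (hFd.trans hHd.symm) hFm.ne_zero (by rw [hFm.leadingCoeff, hHm.leadingCoeff])
  have heval (s : ℝ) : (F - G - H).eval s = s * ∏ i ∈ Finset.range n, (s - 1 - x i)
      - a * ∏ i ∈ Finset.range n, (s - x i) - ∏ j ∈ Finset.range (n + 1), (s - y j) := by
    simp [hF, hG, hH, eval_prod, sub_sub]
  have hzero : F - G - H = 0 := by
    refine eq_zero_of_degree_lt_of_eval_index_eq_zero (v := y) (s := Finset.range (n + 1))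
      hinj hdeg fun j hj => ?_
    rw [heval, hy j (Finset.mem_range.mp hj), Finset.prod_eq_zero hj (sub_self _), sub_zero]
  have := heval t
  rw [hzero, eval_zero] at this
  linarith

/-- The points `x i`, `i < n`, are the roots of `charlier n a` in increasing order, they are
positive and separated by more than `1`. -/
structure IsCharlierRoots (n : ℕ) (a : ℝ) (x : ℕ → ℝ) : Prop where
  pos : ∀ i < n, 0 < x i
  gap : ∀ i j, i < j → j < n → x i + 1 < x j
  eval_eq : ∀ t, (charlier n a).eval t = (-a⁻¹) ^ n * ∏ i ∈ Finset.range n, (t - x i)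

theorem IsCharlierRoots.exists_succ {n : ℕ} {a : ℝ} {x : ℕ → ℝ} (ha : 0 < a)
    (h : IsCharlierRoots n a x) :
    ∃ y : ℕ → ℝ, IsCharlierRoots (n + 1) a y ∧
      ∀ j < n + 1, (∀ i < n, i < j → x i + 1 < y j) ∧ (∀ i < n, j ≤ i → y j < x i) ∧
        y j * ∏ i ∈ Finset.range n, (y j - 1 - x i) - a * ∏ i ∈ Finset.range n, (y j - x i) = 0 := by
  have key (j : ℕ) : ∃ y : ℝ, j < n + 1 → 0 < y ∧ (∀ i < n, i < j → x i + 1 < y) ∧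
      (∀ i < n, j ≤ i → y < x i) ∧
      y * ∏ i ∈ Finset.range n, (y - 1 - x i) - a * ∏ i ∈ Finset.range n, (y - x i) = 0 := by
    by_cases hj : j < n + 1
    · obtain ⟨y, hy⟩ := exists_root_in_gap ha h.pos h.gap (Nat.lt_succ_iff.mp hj)
      exact ⟨y, fun _ => hy⟩
    · exact ⟨0, fun h => absurd h hj⟩
  choose y hy using key
  have hgap : ∀ i j, i < j → j < n + 1 → y i + 1 < y j := fun i j hij hj => by
    linarith [(hy i (by omega)).2.2.1 i (by omega) le_rfl, (hy j hj).2.1 i (by omega) hij]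
  have hinj : Set.InjOn y (Finset.range (n + 1)) := by
    intro i hi j hj hij
    simp only [Finset.coe_range, Set.mem_Iio] at hi hj
    by_contra hne
    rcases lt_or_gt_of_ne hne with hlt | hlt
    · linarith [hgap i j hlt hj]
    · linarith [hgap j i hlt hi]
  refine ⟨y, ⟨fun i hi => (hy i hi).1, hgap, fun t => ?_⟩, fun j hj => (hy j hj).2⟩
  rw [← prod_sub_eq_of_roots hinj (fun j hj => (hy j hj).2.2.2) t, charlier_succ_eval,
    h.eval_eq t, h.eval_eq (t - 1), pow_succ]
  field_simp
  ring

theorem exists_isCharlierRoots_lt {a₁ a₂ : ℝ} (h₁ : 0 < a₁) (h₁₂ : a₁ < a₂) (n : ℕ) :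
    ∃ x₁ x₂ : ℕ → ℝ, IsCharlierRoots n a₁ x₁ ∧ IsCharlierRoots n a₂ x₂ ∧
      ∀ i < n, x₁ i < x₂ i := by
  induction n with
  | zero =>
    have h (a : ℝ) : IsCharlierRoots 0 a 0 :=
      ⟨by simp, by simp, fun t => by simp [charlier_eval]⟩
    exact ⟨0, 0, h a₁, h a₂, by simp⟩
  | succ n ih =>
    obtain ⟨x₁, x₂, hx₁, hx₂, hlt⟩ := ih
    obtain ⟨y₁, hy₁, H₁⟩ := hx₁.exists_succ h₁
    obtain ⟨y₂, hy₂, H₂⟩ := hx₂.exists_succ (h₁.trans h₁₂)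
    refine ⟨y₁, y₂, hy₁, hy₂, fun j hj => ?_⟩
    by_contra! hle
    obtain ⟨lo₁, up₁, e₁⟩ := H₁ j hj
    obtain ⟨lo₂, up₂, e₂⟩ := H₂ j hj
    have hquot {a y : ℝ} {x : ℕ → ℝ} (lo : ∀ i < n, i < j → x i + 1 < y)
        (up : ∀ i < n, j ≤ i → y < x i)
        (e : y * ∏ i ∈ Finset.range n, (y - 1 - x i) - a * ∏ i ∈ Finset.range n, (y - x i) = 0) :
        a = y * ∏ i ∈ Finset.range n, (1 - (y - x i)⁻¹) := by
      have hne : ∀ i ∈ Finset.range n, y - x i ≠ 0 := fun i hi => by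
        rw [Finset.mem_range] at hi
        rcases lt_or_ge i j with h | h
        · exact (show 0 < y - x i by linarith [lo i hi h]).ne'
        · exact (sub_neg.mpr (up i hi h)).ne
      have hprod : (∏ i ∈ Finset.range n, (1 - (y - x i)⁻¹)) * ∏ i ∈ Finset.range n, (y - x i)
          = ∏ i ∈ Finset.range n, (y - 1 - x i) := by
        rw [← Finset.prod_mul_distrib]
        refine Finset.prod_congr rfl fun i hi => ?_
        rw [sub_mul, inv_mul_cancel₀ (hne i hi)]
        ring
      refine mul_right_cancel₀ (Finset.prod_ne_zero_iff.mpr hne) ?_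
      rw [mul_assoc, hprod]
      linarith
    have hfactor : ∀ i ∈ Finset.range n,
        0 ≤ 1 - (y₂ j - x₂ i)⁻¹ ∧ 1 - (y₂ j - x₂ i)⁻¹ ≤ 1 - (y₁ j - x₁ i)⁻¹ := fun i hi => by
      rw [Finset.mem_range] at hi
      have hx := hlt i hi
      rcases lt_or_ge i j with h | h
      · have hl := lo₂ i hi h
        exact ⟨sub_nonneg.mpr (inv_le_one_of_one_le₀ (by linarith)),
          sub_le_sub_left (inv_anti₀ (by linarith) (by linarith)) _⟩
      · have hu₁ := up₁ i hi h
        have hu₂ := up₂ i hi h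
        have hneg : (y₂ j - x₂ i)⁻¹ < 0 := inv_lt_zero.mpr (by linarith)
        exact ⟨by linarith,
          sub_le_sub_left ((inv_le_inv_of_neg (by linarith) (by linarith)).mpr (by linarith)) _⟩
    have : a₂ ≤ a₁ := by
      rw [hquot lo₁ up₁ e₁, hquot lo₂ up₂ e₂]
      exact mul_le_mul hle (Finset.prod_le_prod (fun i hi => (hfactor i hi).1)
        fun i hi => (hfactor i hi).2) (Finset.prod_nonneg fun i hi => (hfactor i hi).1)
        (hy₁.pos j hj).le
    linarith

theorem IsCharlierRoots.isRootTuple {n : ℕ} {a : ℝ} {x : ℕ → ℝ} (ha : 0 < a)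
    (h : IsCharlierRoots n a x) : IsRootTuple (charlier n a) fun i : Fin n => x i := by
  refine ⟨fun i j hij => by linarith [h.gap i j hij j.2], fun y => ?_⟩
  have hc : (-a⁻¹) ^ n ≠ 0 := pow_ne_zero _ (neg_ne_zero.mpr (inv_ne_zero ha.ne'))
  rw [IsRoot.def, h.eval_eq, mul_eq_zero, or_iff_right hc, Finset.prod_eq_zero_iff]
  constructor
  · rintro ⟨i, hi, hy⟩
    exact ⟨⟨i, Finset.mem_range.mp hi⟩, sub_eq_zero.mp hy⟩
  · rintro ⟨i, rfl⟩
    exact ⟨i, Finset.mem_range.mpr i.2, sub_self _⟩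

theorem IsCharlierRoots.rootMultiplicity {n : ℕ} {a : ℝ} {x : ℕ → ℝ} (ha : 0 < a)
    (h : IsCharlierRoots n a x) {j : ℕ} (hj : j < n) :
    (charlier n a).rootMultiplicity (x j) = 1 := by
  have hc : (-a⁻¹) ^ n ≠ 0 := pow_ne_zero _ (neg_ne_zero.mpr (inv_ne_zero ha.ne'))
  have hne : ∀ i ∈ (Finset.range n).erase j, x j - x i ≠ 0 := fun i hi => by
    rw [Finset.mem_erase, Finset.mem_range] at hi
    rcases lt_or_gt_of_ne hi.1 with hlt | hlt
    · exact (show 0 < x j - x i by linarith [h.gap i j hlt hj]).ne'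
    · exact (show x j - x i < 0 by linarith [h.gap j i hlt hi.2]).ne
  set q : ℝ[X] := C ((-a⁻¹) ^ n) * ∏ i ∈ (Finset.range n).erase j, (X - C (x i)) with hq
  have hq_eval : q.eval (x j) ≠ 0 := by
    rw [hq, eval_mul, eval_C, eval_prod]
    simpa only [eval_sub, eval_X, eval_C] using
      mul_ne_zero hc (Finset.prod_ne_zero_iff.mpr hne)
  have hfac : charlier n a = q * (X - C (x j)) ^ 1 := by
    refine Polynomial.funext fun t => ?_
    rw [h.eval_eq, ← Finset.mul_prod_erase _ _ (Finset.mem_range.mpr hj), hq]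
    simp only [eval_mul, eval_C, eval_prod, eval_sub, eval_X, pow_one]
    ring
  have hq0 : q ≠ 0 := by
    rintro h0
    exact hq_eval (by rw [h0, eval_zero])
  rw [hfac, rootMultiplicity_mul_X_sub_C_pow hq0, rootMultiplicity_eq_zero hq_eval]

theorem IsRootTuple.unique {n : ℕ} {p : ℝ[X]} {x y : Fin n → ℝ}
    (hx : IsRootTuple p x) (hy : IsRootTuple p y) : x = y := by
  refine (hx.1.range_inj hy.1).mp (Set.ext fun t => ?_)
  simp only [Set.mem_range, eq_comm (b := t), ← hx.2 t, ← hy.2 t]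

/-- the Charlier polynomial `C_n(·;a)`, `a > 0`, has `n` simple real roots in
`(0,∞)` with consecutive gaps greater than `1`, and each root is strictly increasing in `a`. -/
theorem charlier_roots
    (a : ℝ) (ha : 0 < a) (n : ℕ) (hn : 1 ≤ n) :
    (∃ x : Fin n → ℝ, IsRootTuple (charlier n a) x ∧
      (∀ j, (charlier n a).rootMultiplicity (x j) = 1) ∧
      (∀ j, 0 < x j) ∧ GapGt 1 x) ∧
    (∀ a₁ a₂ : ℝ, 0 < a₁ → a₁ < a₂ →
      ∀ x₁ x₂ : Fin n → ℝ, IsRootTuple (charlier n a₁) x₁ → IsRootTuple (charlier n a₂) x₂ →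
      ∀ j, x₁ j < x₂ j) := by
  constructor
  · obtain ⟨x, -, hx, -⟩ := exists_isCharlierRoots_lt ha (lt_add_one a) n
    exact ⟨fun i => x i, hx.isRootTuple ha, fun j => hx.rootMultiplicity ha j.2,
      fun j => hx.pos j j.2, fun i hi => lt_sub_iff_add_lt'.mpr (hx.gap i (i + 1) (by omega) hi)⟩
  · intro a₁ a₂ h₁ h₁₂ x₁ x₂ hx₁ hx₂ j
    obtain ⟨y₁, y₂, hy₁, hy₂, hlt⟩ := exists_isCharlierRoots_lt h₁ h₁₂ n
    rw [hx₁.unique (hy₁.isRootTuple h₁), hx₂.unique (hy₂.isRootTuple (h₁.trans h₁₂))]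
    exact hlt j j.2
end

section
/- Let N ∈ ℕ, 1 ≤ n ≤ N, p ∈ (0,1) and a > 0 with a > Np/(1−p). Let x_{1,n}^K < ... < x_{n,n}^K denote the roots of the Krawtchouk polynomial K_n(x;p,N) and x_{1,n}^C < ... < x_{n,n}^C denote the roots of the Charlier polynomial C_n(x;a). Then x_{j,n}^K < x_{j,n}^C for every j = 1,...,n. -/
open Polynomial Filter

/-- The polynomial `∑ k ≤ n, binom(n,k) u_k (-x)_k`. -/
noncomputable def binomPoch (n : ℕ) (u : ℕ → ℝ) : Polynomial ℝ :=
  ∑ k ∈ Finset.range (n + 1), Polynomial.C ((n.choose k : ℝ) * u k) * negXPoch k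

lemma negXPoch_zero : negXPoch 0 = 1 := by simp [negXPoch]

lemma eval_negXPoch_succ (k : ℕ) (x : ℝ) :
    (negXPoch (k + 1)).eval x = (negXPoch k).eval x * (k - x) := by
  simp [negXPoch, ascPochhammer_succ_right]
  left; ring

lemma eval_negXPoch_succ' (k : ℕ) (x : ℝ) :
    (negXPoch (k + 1)).eval x = -x * (negXPoch k).eval (x - 1) := by
  simp only [negXPoch, ascPochhammer_succ_left, eval_comp, eval_mul, eval_X, eval_neg, eval_add,
    eval_one]
  ring_nf

lemma eval_negXPoch_succ_add_one (k : ℕ) (x : ℝ) :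
    (negXPoch (k + 1)).eval (x + 1)
      = (negXPoch (k + 1)).eval x - (k + 1) * (negXPoch k).eval x := by
  rw [eval_negXPoch_succ', eval_negXPoch_succ, add_sub_cancel_right]
  ring

lemma natDegree_negXPoch_le (k : ℕ) : (negXPoch k).natDegree ≤ k := by
  refine natDegree_comp_le.trans ?_
  simp [ascPochhammer_natDegree]

lemma natDegree_binomPoch_le (n : ℕ) (u : ℕ → ℝ) : (binomPoch n u).natDegree ≤ n := by
  refine natDegree_sum_le_of_forall_le _ _ fun k hk => ?_
  exact (natDegree_C_mul_le _ _).trans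
    ((natDegree_negXPoch_le k).trans (Nat.lt_succ_iff.mp (Finset.mem_range.mp hk)))

lemma eval_binomPoch (n : ℕ) (u : ℕ → ℝ) (x : ℝ) :
    (binomPoch n u).eval x
      = ∑ k ∈ Finset.range (n + 1), (n.choose k : ℝ) * u k * (negXPoch k).eval x := by
  simp [binomPoch, eval_finsetSum]

lemma eval_binomPoch_congr {n : ℕ} {u v : ℕ → ℝ} (c x : ℝ) (h : ∀ k ≤ n, u k = c * v k) :
    (binomPoch n u).eval x = c * (binomPoch n v).eval x := by
  rw [eval_binomPoch, eval_binomPoch, Finset.mul_sum]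
  refine Finset.sum_congr rfl fun k hk => ?_
  rw [h k (Nat.lt_succ_iff.mp (Finset.mem_range.mp hk))]
  ring

lemma sum_choose_mul_eval_negXPoch_succ (n : ℕ) (v : ℕ → ℝ) (x : ℝ) :
    ∑ k ∈ Finset.range (n + 1), (n.choose k : ℝ) * v k * (negXPoch (k + 1)).eval x
      = -x * (binomPoch n v).eval (x - 1) := by
  rw [eval_binomPoch, Finset.mul_sum]
  refine Finset.sum_congr rfl fun k _ => ?_
  rw [eval_negXPoch_succ']
  ring

lemma eval_binomPoch_succ (n : ℕ) (u : ℕ → ℝ) (x : ℝ) :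
    (binomPoch (n + 1) u).eval x
      = (binomPoch n u).eval x - x * (binomPoch n fun k => u (k + 1)).eval (x - 1) := by
  have h1 : (binomPoch n u).eval x
      = ∑ k ∈ Finset.range (n + 1 + 1), (n.choose k : ℝ) * u k * (negXPoch k).eval x := by
    rw [Finset.sum_range_succ, eval_binomPoch]
    simp
  have h2 := sum_choose_mul_eval_negXPoch_succ n (fun k => u (k + 1)) x
  rw [h1, Finset.sum_range_succ', eval_binomPoch, Finset.sum_range_succ', sub_eq_add_neg,
    ← neg_mul, ← h2, add_right_comm, ← Finset.sum_add_distrib]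
  congr 1
  · refine Finset.sum_congr rfl fun k _ => ?_
    rw [Nat.choose_succ_succ]
    push_cast
    ring
  · simp

lemma eval_binomPoch_succ_add_one (n : ℕ) (u : ℕ → ℝ) (x : ℝ) :
    (binomPoch (n + 1) u).eval (x + 1)
      = (binomPoch (n + 1) u).eval x - (n + 1) * (binomPoch n fun k => u (k + 1)).eval x := by
  rw [eval_binomPoch, eval_binomPoch, eval_binomPoch, Finset.sum_range_succ',
    Finset.sum_range_succ' _ (n + 1), Finset.mul_sum, add_sub_right_comm,
    ← Finset.sum_sub_distrib]
  congr 1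
  · refine Finset.sum_congr rfl fun k _ => ?_
    have h : ((n + 1 : ℝ)) * (n.choose k) = ((n + 1).choose (k + 1)) * (k + 1) := by
      exact_mod_cast Nat.add_one_mul_choose_eq n k
    rw [eval_negXPoch_succ_add_one]
    linear_combination (u (k + 1) * (negXPoch k).eval x) * h
  · simp [negXPoch_zero]

lemma poch_neg_natCast (n k : ℕ) :
    poch (-(n : ℝ)) k = (-1) ^ k * (n.descFactorial k : ℝ) := by
  rw [poch, ascPochhammer_eval_neg_eq_descPochhammer, descPochhammer_eval_eq_descFactorial]

lemma charlier_eq_binomPoch (n : ℕ) (a : ℝ) :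
    charlier n a = binomPoch n fun k => (1 / a) ^ k := by
  refine Finset.sum_congr rfl fun k _ => ?_
  congr 2
  have h : (k.factorial : ℝ) ≠ 0 := by exact_mod_cast k.factorial_ne_zero
  rw [poch_neg_natCast, Nat.descFactorial_eq_factorial_mul_choose, neg_div, neg_pow (1 / a)]
  push_cast
  have h1 : ((-1 : ℝ) ^ k) * (-1) ^ k = 1 := by rw [← mul_pow]; simp
  rw [mul_div_assoc, mul_div_cancel_left₀ _ h]
  linear_combination (n.choose k : ℝ) * (1 / a) ^ k * h1

/-- The coefficient sequence of the Krawtchouk polynomials `K_n(·;p,N)` in `binomPoch n`. -/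
noncomputable def krawtchoukCoeff (p : ℝ) (N k : ℕ) : ℝ := (1 / p) ^ k / (N.descFactorial k : ℝ)

lemma krawtchouk_eq_binomPoch (n : ℕ) (p : ℝ) (N : ℕ) :
    krawtchouk n p N = binomPoch n (krawtchoukCoeff p N) := by
  refine Finset.sum_congr rfl fun k _ => ?_
  congr 2
  have h : (k.factorial : ℝ) ≠ 0 := by exact_mod_cast k.factorial_ne_zero
  rw [poch_neg_natCast, poch_neg_natCast, Nat.descFactorial_eq_factorial_mul_choose n k,
    krawtchoukCoeff]
  push_cast
  have h1 : ((-1 : ℝ) ^ k) ≠ 0 := by simp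
  rw [show ((-1 : ℝ) ^ k * ((k.factorial : ℝ) * (n.choose k : ℝ)))
      / ((k.factorial : ℝ) * ((-1) ^ k * (N.descFactorial k : ℝ)))
      = ((k.factorial : ℝ) * (-1) ^ k) * (n.choose k : ℝ)
        / (((k.factorial : ℝ) * (-1) ^ k) * (N.descFactorial k : ℝ)) by ring_nf,
    mul_div_mul_left _ _ (mul_ne_zero h h1)]
  ring

lemma krawtchoukCoeff_succ (p : ℝ) (N k : ℕ) :
    krawtchoukCoeff p (N + 1) (k + 1) = (1 / ((N + 1) * p)) * krawtchoukCoeff p N k := by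
  rw [krawtchoukCoeff, krawtchoukCoeff, Nat.succ_descFactorial_succ, pow_succ]
  push_cast
  simp only [div_eq_mul_inv, mul_inv]
  ring

lemma krawtchoukCoeff_succ_left (p : ℝ) {N k : ℕ} (h : k ≤ N) :
    (N + 1 : ℝ) * krawtchoukCoeff p (N + 1) k = (N + 1 - k) * krawtchoukCoeff p N k := by
  have h1 : ((N.descFactorial k : ℕ) : ℝ) ≠ 0 := by
    exact_mod_cast (Nat.descFactorial_eq_zero_iff_lt.not.mpr (by omega))
  have h2 : (((N + 1).descFactorial k : ℕ) : ℝ) ≠ 0 := by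
    exact_mod_cast (Nat.descFactorial_eq_zero_iff_lt.not.mpr (by omega))
  have h3 : ((N + 1 - k : ℝ)) * ((N + 1).descFactorial k) = (N + 1) * N.descFactorial k := by
    have := Nat.succ_descFactorial N k
    zify [show k ≤ N + 1 by omega] at this
    exact_mod_cast this
  rw [krawtchoukCoeff, krawtchoukCoeff, ← mul_div_assoc, ← mul_div_assoc, div_eq_div_iff h2 h1]
  linear_combination -(1 / p) ^ k * h3

lemma charlier_succ (n : ℕ) (a x : ℝ) :
    (charlier (n + 1) a).eval x
      = (charlier n a).eval x - 1 / a * x * (charlier n a).eval (x - 1) := by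
  simp only [charlier_eq_binomPoch]
  rw [eval_binomPoch_succ, eval_binomPoch_congr (1 / a) (x - 1) fun k _ => pow_succ' (1 / a) k]
  ring

lemma charlier_succ_add_one (n : ℕ) (a x : ℝ) :
    (charlier (n + 1) a).eval (x + 1)
      = (charlier (n + 1) a).eval x - (n + 1) * (1 / a) * (charlier n a).eval x := by
  simp only [charlier_eq_binomPoch]
  rw [eval_binomPoch_succ_add_one, eval_binomPoch_congr (1 / a) x fun k _ => pow_succ' (1 / a) k]
  ring

lemma krawtchouk_succ {n N : ℕ} (hn : n ≤ N) (p x : ℝ) :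
    (krawtchouk (n + 1) p (N + 1)).eval x
      = (N + 1 - x) / (N + 1) * (krawtchouk n p N).eval x
        - (1 / p - 1) / (N + 1) * x * (krawtchouk n p N).eval (x - 1) := by
  have hN : (N + 1 : ℝ) ≠ 0 := by positivity
  simp only [krawtchouk_eq_binomPoch]
  rw [eval_binomPoch_succ,
    eval_binomPoch_congr (1 / ((N + 1) * p)) (x - 1) fun k _ => krawtchoukCoeff_succ p N k]
  have h : (N + 1 : ℝ) * (binomPoch n (krawtchoukCoeff p (N + 1))).eval x
      = (N + 1 - x) * (binomPoch n (krawtchoukCoeff p N)).eval x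
        - -x * (binomPoch n (krawtchoukCoeff p N)).eval (x - 1) := by
    rw [← sum_choose_mul_eval_negXPoch_succ, eval_binomPoch, eval_binomPoch, Finset.mul_sum,
      Finset.mul_sum, ← Finset.sum_sub_distrib]
    refine Finset.sum_congr rfl fun k hk => ?_
    have := krawtchoukCoeff_succ_left p ((Nat.lt_succ_iff.mp (Finset.mem_range.mp hk)).trans hn)
    rw [eval_negXPoch_succ]
    linear_combination (n.choose k : ℝ) * (negXPoch k).eval x * this
  have h' : (binomPoch n (krawtchoukCoeff p (N + 1))).eval x
      = ((N + 1 - x) * (binomPoch n (krawtchoukCoeff p N)).eval x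
        - -x * (binomPoch n (krawtchoukCoeff p N)).eval (x - 1)) / (N + 1) := by
    rw [← h, mul_div_cancel_left₀ _ hN]
  rw [h']
  simp only [div_eq_mul_inv, mul_inv]
  ring

lemma krawtchouk_succ_add_one (n N : ℕ) (p x : ℝ) :
    (krawtchouk (n + 1) p (N + 1)).eval (x + 1)
      = (krawtchouk (n + 1) p (N + 1)).eval x
        - (n + 1) * (1 / ((N + 1) * p)) * (krawtchouk n p N).eval x := by
  simp only [krawtchouk_eq_binomPoch]
  rw [eval_binomPoch_succ_add_one,
    eval_binomPoch_congr (1 / ((N + 1) * p)) x fun k _ => krawtchoukCoeff_succ p N k]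
  ring

/-- `P` is a positive multiple of `∏ k < n, (z k - X)`, where the `z k` are positive and
consecutive ones are more than `1` apart. -/
structure GapFactored (P : Polynomial ℝ) (n : ℕ) (z : ℕ → ℝ) : Prop where
  pos : ∀ j < n, 0 < z j
  gap : ∀ i j, i < j → j < n → z i + 1 < z j
  factor : ∃ c : ℝ, 0 < c ∧ ∀ x, P.eval x = c * ∏ k ∈ Finset.range n, (z k - x)

lemma neg_one_pow_mul_prod_sub_pos {n m : ℕ} (hm : m ≤ n) {z : ℕ → ℝ} {x : ℝ}
    (h1 : ∀ k < m, z k < x) (h2 : ∀ k, m ≤ k → k < n → x < z k) :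
    0 < (-1) ^ m * ∏ k ∈ Finset.range n, (z k - x) := by
  rw [← Finset.prod_range_mul_prod_Ico _ hm, ← mul_assoc]
  refine mul_pos ?_ (Finset.prod_pos fun k hk => ?_)
  · rw [← Finset.card_range m, ← Finset.prod_const, Finset.card_range,
      ← Finset.prod_mul_distrib]
    refine Finset.prod_pos fun k hk => ?_
    linarith [h1 k (Finset.mem_range.mp hk)]
  · have := Finset.mem_Ico.mp hk
    linarith [h2 k this.1 this.2]

lemma GapFactored.neg_one_pow_mul_eval_pos {P : Polynomial ℝ} {n m : ℕ} {z : ℕ → ℝ}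
    (hP : GapFactored P n z) (hm : m ≤ n) {x : ℝ}
    (h1 : ∀ k < m, z k < x) (h2 : ∀ k, m ≤ k → k < n → x < z k) :
    0 < (-1) ^ m * P.eval x := by
  obtain ⟨c, hc, h⟩ := hP.factor
  have := mul_pos hc (neg_one_pow_mul_prod_sub_pos hm h1 h2)
  rw [h]
  linarith

lemma GapFactored.eval_root {P : Polynomial ℝ} {n : ℕ} {z : ℕ → ℝ} (hP : GapFactored P n z)
    {j : ℕ} (hj : j < n) : P.eval (z j) = 0 := by
  obtain ⟨c, -, h⟩ := hP.factor
  rw [h, Finset.prod_eq_zero (Finset.mem_range.mpr hj) (sub_self _), mul_zero]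

lemma GapFactored.zero {P : Polynomial ℝ} (hP : P = 1) (z : ℕ → ℝ) : GapFactored P 0 z where
  pos := by simp
  gap := by simp
  factor := ⟨1, one_pos, by simp [hP]⟩

lemma exists_factor_of_roots {Q : Polynomial ℝ} {n : ℕ} {w : ℕ → ℝ} (hdeg : Q.natDegree ≤ n)
    (hpos : ∀ j < n, 0 < w j) (hinj : Set.InjOn w (Finset.range n))
    (hroot : ∀ j < n, Q.eval (w j) = 0) (h0 : 0 < Q.eval 0) :
    ∃ c : ℝ, 0 < c ∧ ∀ x, Q.eval x = c * ∏ k ∈ Finset.range n, (w k - x) := by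
  have hprod : 0 < ∏ k ∈ Finset.range n, w k :=
    Finset.prod_pos fun k hk => hpos k (Finset.mem_range.mp hk)
  set c := Q.eval 0 / ∏ k ∈ Finset.range n, w k with hc
  set R : Polynomial ℝ := C c * ∏ k ∈ Finset.range n, (C (w k) - X) with hR
  have hReval : ∀ x, R.eval x = c * ∏ k ∈ Finset.range n, (w k - x) := fun x => by
    simp [hR, eval_prod]
  have hRdeg : R.natDegree ≤ n := by
    refine (natDegree_C_mul_le _ _).trans ((natDegree_prod_le _ _).trans ?_)
    refine (Finset.sum_le_card_nsmul _ _ 1 fun k _ => ?_).trans (by simp)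
    exact (natDegree_sub_le _ _).trans (by simp)
  have hnot : (0 : ℝ) ∉ (Finset.range n).image w := by
    simp only [Finset.mem_image, Finset.mem_range, not_exists, not_and]
    exact fun k hk => (hpos k hk).ne'
  have hcard : (insert 0 ((Finset.range n).image w)).card = n + 1 := by
    rw [Finset.card_insert_of_notMem hnot, Finset.card_image_of_injOn hinj, Finset.card_range]
  have hlt : ∀ S : Polynomial ℝ, S.natDegree ≤ n →
      S.degree < (insert 0 ((Finset.range n).image w)).card := fun S hS => by
    rw [hcard]
    exact degree_le_natDegree.trans_lt (by exact_mod_cast Nat.lt_succ_of_le hS)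
  have hQR : Q = R := by
    refine eq_of_degrees_lt_of_eval_finset_eq _ (hlt Q hdeg) (hlt R hRdeg) fun x hx => ?_
    rw [hReval]
    rcases Finset.mem_insert.mp hx with rfl | hx
    · simp only [sub_zero]
      rw [hc, div_mul_cancel₀ _ hprod.ne']
    · obtain ⟨k, hk, rfl⟩ := Finset.mem_image.mp hx
      rw [hroot k (Finset.mem_range.mp hk), Finset.prod_eq_zero hk (sub_self _), mul_zero]
  exact ⟨c, div_pos h0 hprod, fun x => hQR ▸ hReval x⟩

/-- Raising the degree by `Q(x) = α(x) P(x) - β x P(x - 1)` produces one more root and keeps the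
gaps between consecutive roots larger than `1`. -/
lemma GapFactored.exists_succ {P Q : Polynomial ℝ} {n : ℕ} {z : ℕ → ℝ} (hP : GapFactored P n z)
    {α : ℝ → ℝ} {β T : ℝ} (hβ : 0 < β) (hα0 : 0 < α 0) (hα : ∀ j < n, 0 < α (z j + 1))
    (hdeg : Q.natDegree ≤ n + 1)
    (hQ : ∀ x, Q.eval x = α x * P.eval x - β * x * P.eval (x - 1))
    (hT0 : 0 < T) (hT : ∀ j < n, z j + 1 < T) (hQT : 0 < (-1) ^ (n + 1) * Q.eval T) :
    ∃ w, GapFactored Q (n + 1) w ∧ ∀ j < n + 1, w j < T := by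
  have hmono : ∀ i j, i ≤ j → j < n → z i ≤ z j := fun i j hij hj => by
    rcases hij.eq_or_lt with rfl | hij
    · exact le_rfl
    · linarith [hP.gap i j hij hj]
  have hQ0 : 0 < Q.eval 0 := by
    have := hP.neg_one_pow_mul_eval_pos (m := 0) (x := 0) (by simp) (by simp)
      fun k _ hk => hP.pos k hk
    rw [hQ]
    simp only [pow_zero, one_mul] at this
    have := mul_pos hα0 this
    linarith
  have hleft : ∀ j < n, 0 < (-1) ^ (j + 1) * Q.eval (z j + 1) := fun j hj => by
    have := hP.neg_one_pow_mul_eval_pos (m := j + 1) (x := z j + 1) hj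
      (fun k hk => by linarith [hmono k j (by omega) hj])
      (fun k hk hkn => hP.gap j k (by omega) hkn)
    rw [hQ, add_sub_cancel_right, hP.eval_root hj]
    have := mul_pos (hα j hj) this
    linarith
  have hright : ∀ j < n, (-1) ^ j * Q.eval (z j) < 0 := fun j hj => by
    have := hP.neg_one_pow_mul_eval_pos (m := j) (x := z j - 1) hj.le
      (fun k hk => by linarith [hP.gap k j hk hj])
      (fun k hk hkn => by linarith [hmono j k hk hkn])
    rw [hQ, hP.eval_root hj]
    have := mul_pos (mul_pos hβ (hP.pos j hj)) this
    linarith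
  have hex : ∀ j, ∃ w, j < n + 1 → Q.eval w = 0 ∧ 0 < w ∧ w < T ∧
      (∀ i < j, z i + 1 < w) ∧ (j < n → w < z j) := fun j => by
    by_cases hj : j < n + 1
    swap
    · exact ⟨0, fun h => absurd h hj⟩
    obtain ⟨l, hl0, hlT, hlz, hlr, hlQ⟩ : ∃ l, 0 ≤ l ∧ l < T ∧ (∀ i < j, z i + 1 ≤ l) ∧
        (j < n → l < z j) ∧ 0 < (-1) ^ j * Q.eval l := by
      rcases j with _ | j
      · exact ⟨0, le_rfl, hT0, by simp, fun h => hP.pos 0 h, by simpa using hQ0⟩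
      · have hjn : j < n := by omega
        exact ⟨z j + 1, by linarith [hP.pos j hjn], hT j hjn,
          fun i hi => by linarith [hmono i j (by omega) hjn],
          fun h => hP.gap j (j + 1) (by omega) h, hleft j hjn⟩
    obtain ⟨r, hlr, hrT, hrz, hrQ⟩ : ∃ r, l < r ∧ r ≤ T ∧ (j < n → r ≤ z j) ∧
        (-1) ^ j * Q.eval r < 0 := by
      by_cases hjn : j < n
      · exact ⟨z j, hlr hjn, by linarith [hT j hjn], fun _ => le_rfl, hright j hjn⟩
      · obtain rfl : j = n := by omega
        refine ⟨T, hlT, le_rfl, fun h => absurd h hjn, ?_⟩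
        rw [pow_succ] at hQT
        linarith
    have hcont : ContinuousOn (fun x => (-1) ^ j * Q.eval x) (Set.Icc l r) := by fun_prop
    obtain ⟨w, ⟨hlw, hwr⟩, hw⟩ := intermediate_value_Ioo' hlr.le hcont ⟨hrQ, hlQ⟩
    refine ⟨w, fun _ => ⟨?_, by linarith, by linarith,
      fun i hi => by linarith [hlz i hi], fun h => by linarith [hrz h]⟩⟩
    simpa using hw
  choose w hw using hex
  have hgap : ∀ i j, i < j → j < n + 1 → w i + 1 < w j := fun i j hij hj => by
    linarith [(hw i (by omega)).2.2.2.2 (by omega), (hw j hj).2.2.2.1 i hij]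
  refine ⟨w, ⟨fun j hj => (hw j hj).2.1, hgap, ?_⟩, fun j hj => (hw j hj).2.2.1⟩
  refine exists_factor_of_roots hdeg (fun j hj => (hw j hj).2.1) ?_ (fun j hj => (hw j hj).1) hQ0
  intro i hi j hj hij
  simp only [Finset.coe_range, Set.mem_Iio] at hi hj
  rcases lt_trichotomy i j with h | h | h
  · linarith [hgap i j h hj]
  · exact h
  · linarith [hgap j i h hi]

lemma exists_gapFactored_krawtchouk {p : ℝ} (hp : 0 < p) (hp1 : p < 1) (n : ℕ) :
    ∀ N, n ≤ N → ∃ z, GapFactored (krawtchouk n p N) n z ∧ ∀ j < n, z j < N := by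
  induction n with
  | zero =>
    intro N _
    refine ⟨fun _ => 0, GapFactored.zero ?_ _, by simp⟩
    simp [krawtchouk, negXPoch_zero, poch]
  | succ n ih =>
    intro N hN
    obtain ⟨M, rfl⟩ : ∃ M, N = M + 1 := ⟨N - 1, by omega⟩
    have hnM : n ≤ M := by omega
    have hM : (0 : ℝ) < M + 1 := by positivity
    obtain ⟨z, hz, hzM⟩ := ih M hnM
    have hβ : 0 < (1 / p - 1) / ((M : ℝ) + 1) :=
      div_pos (sub_pos.mpr ((one_lt_div hp).mpr hp1)) hM
    have hdeg : (krawtchouk (n + 1) p (M + 1)).natDegree ≤ n + 1 := by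
      rw [krawtchouk_eq_binomPoch]
      exact natDegree_binomPoch_le _ _
    have := hz.exists_succ (α := fun x => (M + 1 - x) / (M + 1)) (T := M + 1) hβ
      (by simp [hM.ne']) (fun j hj => div_pos (by linarith [hzM j hj]) hM)
      hdeg (krawtchouk_succ hnM p) hM (fun j hj => by linarith [hzM j hj]) ?_
    · push_cast
      exact this
    · have h := hz.neg_one_pow_mul_eval_pos (m := n) (x := M) le_rfl hzM (fun k h1 h2 => by omega)
      rw [krawtchouk_succ hnM, add_sub_cancel_right, pow_succ]
      have := mul_pos (mul_pos hβ hM) h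
      rw [sub_self, zero_div, zero_mul]
      linarith

lemma exists_gapFactored_charlier {a : ℝ} (ha : 0 < a) (n : ℕ) :
    ∃ z, GapFactored (charlier n a) n z := by
  induction n with
  | zero =>
    refine ⟨fun _ => 0, GapFactored.zero ?_ _⟩
    simp [charlier, negXPoch_zero, poch]
  | succ n ih =>
    obtain ⟨z, hz⟩ := ih
    obtain ⟨c, hc, hfac⟩ := hz.factor
    have hdeg : (charlier (n + 1) a).natDegree ≤ n + 1 := by
      rw [charlier_eq_binomPoch]
      exact natDegree_binomPoch_le _ _
    have hS : ∀ k < n, z k ≤ ∑ j ∈ Finset.range n, z j := fun k hk =>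
      Finset.single_le_sum (fun i hi => (hz.pos i (Finset.mem_range.mp hi)).le)
        (Finset.mem_range.mpr hk)
    have hS0 : 0 ≤ ∑ j ∈ Finset.range n, z j :=
      Finset.sum_nonneg fun i hi => (hz.pos i (Finset.mem_range.mp hi)).le
    have h2 : 0 < a * 2 ^ n := by positivity
    set T := ∑ j ∈ Finset.range n, z j + 2 + a * 2 ^ n
    have hzT : ∀ k < n, z k + 2 < T := fun k hk => by linarith [hS k hk]
    have hQT : 0 < (-1) ^ (n + 1) * (charlier (n + 1) a).eval T := by
      have hsign : ∀ x : ℝ, (-1) ^ n * ∏ k ∈ Finset.range n, (z k - x)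
          = ∏ k ∈ Finset.range n, (x - z k) := fun x => by
        conv_lhs => rw [← Finset.card_range n, ← Finset.prod_const, Finset.card_range,
          ← Finset.prod_mul_distrib]
        exact Finset.prod_congr rfl fun k _ => by ring
      have hpos : 0 < ∏ k ∈ Finset.range n, (T - 1 - z k) := Finset.prod_pos fun k hk => by
        linarith [hzT k (Finset.mem_range.mp hk)]
      have hle : ∏ k ∈ Finset.range n, (T - z k)
          ≤ 2 ^ n * ∏ k ∈ Finset.range n, (T - 1 - z k) := by
        conv_rhs => rw [← Finset.card_range n, ← Finset.prod_const, Finset.card_range,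
          ← Finset.prod_mul_distrib]
        refine Finset.prod_le_prod (fun k hk => ?_) fun k hk => ?_ <;>
          linarith [hzT k (Finset.mem_range.mp hk)]
      have hTa : 2 ^ n < 1 / a * T := by
        rw [one_div_mul_eq_div, lt_div_iff₀ ha]
        linarith
      have hlt := hle.trans_lt (mul_lt_mul_of_pos_right hTa hpos)
      rw [charlier_succ, hfac, hfac, pow_succ]
      have := mul_pos hc (sub_pos.mpr hlt)
      rw [← hsign, ← hsign] at this
      linarith
    obtain ⟨w, hw, -⟩ := hz.exists_succ (α := fun _ => 1) (T := T) (one_div_pos.mpr ha) one_pos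
      (fun _ _ => one_pos) hdeg (fun x => by rw [charlier_succ, one_mul]) (by linarith)
      (fun j hj => by linarith [hzT j hj]) hQT
    exact ⟨w, hw⟩

lemma GapFactored.eq_root_of_isRootTuple {P : Polynomial ℝ} {n : ℕ} {z : ℕ → ℝ}
    (hP : GapFactored P n z) {x : Fin n → ℝ} (hx : IsRootTuple P x) (j : Fin n) : x j = z j := by
  have hmono : StrictMono fun i : Fin n => z i := fun i k hik => by
    have := hP.gap i k hik k.isLt
    show z i < z k
    linarith
  have hrange : Set.range x = Set.range fun i : Fin n => z i := by
    ext y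
    have h : y ∈ Set.range x ↔ P.IsRoot y := by
      rw [hx.2 y]
      exact ⟨fun ⟨i, hi⟩ => ⟨i, hi.symm⟩, fun ⟨i, hi⟩ => ⟨i, hi.symm⟩⟩
    rw [h]
    obtain ⟨c, hc, hfac⟩ := hP.factor
    rw [IsRoot.def, hfac, mul_eq_zero, Finset.prod_eq_zero_iff]
    constructor
    · rintro (h | ⟨k, hk, h⟩)
      · exact absurd h hc.ne'
      · exact ⟨⟨k, Finset.mem_range.mp hk⟩, sub_eq_zero.mp h⟩
    · rintro ⟨k, rfl⟩
      exact Or.inr ⟨k, Finset.mem_range.mpr k.isLt, sub_self _⟩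
  exact congrFun ((hx.1.range_inj hmono).mp hrange) j

/-- The difference equation at a root, written as an equilibrium condition between roots. -/
lemma GapFactored.eq_mul_prod_div {P : Polynomial ℝ} {n : ℕ} {z : ℕ → ℝ}
    (hP : GapFactored P n z) {j : ℕ} (hj : j < n) {b : ℝ}
    (h : b * P.eval (z j + 1) + z j * P.eval (z j - 1) = 0) :
    z j = b * ∏ k ∈ (Finset.range n).erase j, ((z k - z j - 1) / (z k - z j + 1)) := by
  obtain ⟨c, hc, hfac⟩ := hP.factor
  have hmem := Finset.mem_range.mpr hj
  have hne : ∏ k ∈ (Finset.range n).erase j, (z k - z j + 1) ≠ 0 := by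
    refine Finset.prod_ne_zero_iff.mpr fun k hk => ?_
    obtain ⟨hkj, hk⟩ := Finset.mem_erase.mp hk
    have hk := Finset.mem_range.mp hk
    rcases lt_or_gt_of_ne hkj with h | h
    · exact ne_of_lt (by linarith [hP.gap k j h hj])
    · exact ne_of_gt (by linarith [hP.gap j k h hk])
  rw [hfac, hfac, ← Finset.mul_prod_erase _ _ hmem, ← Finset.mul_prod_erase _ _ hmem] at h
  rw [Finset.prod_div_distrib, ← mul_div_assoc, eq_div_iff hne]
  simp only [← sub_sub, sub_sub_eq_add_sub, add_sub_right_comm, sub_self, zero_add, zero_sub] at h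
  refine mul_left_cancel₀ hc.ne' ?_
  linarith

lemma div_sub_one_add_one_pos {t : ℝ} (ht : t < -1 ∨ 1 < t) : 0 < (t - 1) / (t + 1) := by
  rcases ht with ht | ht
  · exact div_pos_of_neg_of_neg (by linarith) (by linarith)
  · exact div_pos (by linarith) (by linarith)

lemma div_sub_one_add_one_le {s t : ℝ} (hts : t ≤ s) (h : s < -1 ∨ 1 < t) :
    (t - 1) / (t + 1) ≤ (s - 1) / (s + 1) := by
  rcases h with h | h
  · rw [← neg_div_neg_eq, ← neg_div_neg_eq (s - 1), div_le_div_iff₀ (by linarith) (by linarith)]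
    nlinarith
  · rw [div_le_div_iff₀ (by linarith) (by linarith)]
    nlinarith

/-- Comparison of two equilibrium configurations: a smaller force pushes the roots left. -/
lemma GapFactored.lt_of_equilibrium {P Q : Polynomial ℝ} {n : ℕ} {x y : ℕ → ℝ}
    (hP : GapFactored P n x) (hQ : GapFactored Q n y) {b : ℝ → ℝ} {a : ℝ}
    (hb : ∀ j < n, b (x j) < a) (ha : 0 < a)
    (hPeq : ∀ j < n, b (x j) * P.eval (x j + 1) + x j * P.eval (x j - 1) = 0)
    (hQeq : ∀ j < n, a * Q.eval (y j + 1) + y j * Q.eval (y j - 1) = 0) :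
    ∀ j < n, x j < y j := by
  intro i hi
  obtain ⟨j, hjmem, hmax⟩ := Finset.exists_max_image (Finset.range n) (fun k => x k - y k)
    ⟨i, Finset.mem_range.mpr hi⟩
  have hj := Finset.mem_range.mp hjmem
  suffices hlt : x j < y j by linarith [hmax i (Finset.mem_range.mpr hi)]
  by_contra! hge
  have hsep : ∀ k ∈ (Finset.range n).erase j,
      (x k - x j < -1 ∧ y k - y j < -1) ∨ (1 < x k - x j ∧ 1 < y k - y j) := fun k hk => by
    obtain ⟨hkj, hk⟩ := Finset.mem_erase.mp hk
    have hk := Finset.mem_range.mp hk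
    rcases lt_or_gt_of_ne hkj with h | h
    · exact Or.inl ⟨by linarith [hP.gap k j h hj], by linarith [hQ.gap k j h hj]⟩
    · exact Or.inr ⟨by linarith [hP.gap j k h hk], by linarith [hQ.gap j k h hk]⟩
  have hpos : 0 < ∏ k ∈ (Finset.range n).erase j, ((x k - x j - 1) / (x k - x j + 1)) :=
    Finset.prod_pos fun k hk => div_sub_one_add_one_pos ((hsep k hk).imp And.left And.left)
  have hle : ∏ k ∈ (Finset.range n).erase j, ((x k - x j - 1) / (x k - x j + 1))
      ≤ ∏ k ∈ (Finset.range n).erase j, ((y k - y j - 1) / (y k - y j + 1)) := by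
    refine Finset.prod_le_prod (fun k hk =>
      (div_sub_one_add_one_pos ((hsep k hk).imp And.left And.left)).le) fun k hk => ?_
    refine div_sub_one_add_one_le ?_ ((hsep k hk).imp And.right And.left)
    linarith [hmax k (Finset.mem_of_mem_erase hk)]
  have hx := hP.eq_mul_prod_div hj (hPeq j hj)
  have hy := hQ.eq_mul_prod_div hj (hQeq j hj)
  have h1 := mul_lt_mul_of_pos_right (hb j hj) hpos
  have h2 := mul_le_mul_of_nonneg_left hle ha.le
  linarith

lemma charlier_differenceEq_at_root {n : ℕ} {a : ℝ} (ha : 0 < a) {x : ℝ}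
    (hx : (charlier (n + 1) a).eval x = 0) :
    a * (charlier (n + 1) a).eval (x + 1) + x * (charlier (n + 1) a).eval (x - 1) = 0 := by
  have h1 := charlier_succ n a x
  have h2 := charlier_succ_add_one n a x
  have h3 := charlier_succ_add_one n a (x - 1)
  rw [sub_add_cancel] at h3
  rw [hx] at h1 h2 h3
  field_simp at h1 h2 h3
  refine mul_left_cancel₀ ha.ne' ?_
  linear_combination a * h2 - x * h3 + (n + 1) * h1

lemma krawtchouk_differenceEq_at_root {n N : ℕ} (hn : n ≤ N) {p : ℝ} (hp : 0 < p) (hp1 : p < 1)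
    {x : ℝ} (hx : (krawtchouk (n + 1) p (N + 1)).eval x = 0) :
    p * (N + 1 - x) / (1 - p) * (krawtchouk (n + 1) p (N + 1)).eval (x + 1)
      + x * (krawtchouk (n + 1) p (N + 1)).eval (x - 1) = 0 := by
  have h1 := krawtchouk_succ hn p x
  have h2 := krawtchouk_succ_add_one n N p x
  have h3 := krawtchouk_succ_add_one n N p (x - 1)
  rw [sub_add_cancel] at h3
  rw [hx] at h1 h2 h3
  have hp1' : 1 - p ≠ 0 := by linarith
  have hN : (N + 1 : ℝ) ≠ 0 := by positivity
  set A := (krawtchouk (n + 1) p (N + 1)).eval (x + 1)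
  set B := (krawtchouk (n + 1) p (N + 1)).eval (x - 1)
  set D := (krawtchouk n p N).eval x
  set E := (krawtchouk n p N).eval (x - 1)
  rw [h2, eq_add_of_sub_eq h3.symm]
  field_simp at h1 ⊢
  linear_combination (n + 1) * h1

/-- if `a > Np/(1-p)`, the roots of the Krawtchouk polynomial `K_n(·;p,N)` are
componentwise smaller than the roots of the Charlier polynomial `C_n(·;a)`. -/
theorem krawtchouk_roots_lt_charlier_roots
    (N : ℕ) (n : ℕ) (hn : 1 ≤ n) (hnN : n ≤ N)
    (p a : ℝ) (hp : 0 < p) (hp1 : p < 1) (ha : 0 < a)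
    (hcond : (N : ℝ) * p / (1 - p) < a)
    (xK xC : Fin n → ℝ)
    (hK : IsRootTuple (krawtchouk n p N) xK) (hC : IsRootTuple (charlier n a) xC) :
    ∀ j, xK j < xC j := by
  obtain ⟨m, rfl⟩ : ∃ m, n = m + 1 := ⟨n - 1, by omega⟩
  obtain ⟨M, rfl⟩ : ∃ M, N = M + 1 := ⟨N - 1, by omega⟩
  obtain ⟨x, hx, hxN⟩ := exists_gapFactored_krawtchouk hp hp1 (m + 1) (M + 1) hnN
  obtain ⟨y, hy⟩ := exists_gapFactored_charlier ha (m + 1)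
  intro j
  rw [hx.eq_root_of_isRootTuple hK, hy.eq_root_of_isRootTuple hC]
  refine hx.lt_of_equilibrium hy (b := fun t => p * (M + 1 - t) / (1 - p)) (fun k hk => ?_) ha
    (fun k hk => krawtchouk_differenceEq_at_root (by omega) hp hp1 (hx.eval_root hk))
    (fun k hk => charlier_differenceEq_at_root ha (hy.eval_root hk)) j j.isLt
  refine lt_of_le_of_lt ?_ hcond
  push_cast
  have : 0 < p * x k := mul_pos hp (hx.pos k hk)
  exact div_le_div_of_nonneg_right (by linarith) (by linarith)
end
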